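/- Let A > 0 and c > 0 be fixed. There exists B₀ = B₀(A, c) > 0 such that the following holds for every B ≥ B₀. Let x be sufficiently large, L = log x, and x^{1/2} ≤ y ≤ x. Suppose α ∈ ℝ and a, q ∈ ℤ satisfy L^B ≤ q ≤ y L^{−B}, gcd(a,q) = 1 and |α − a/q| < q^{−2}. Let (a_m) and (b_k) be complex numbers with |a_m| ≤ τ(m)^c and |b_k| ≤ τ(k)^c, and suppose L^B ≤ M ≤ y x^{−1/2} L^{−B}. Then ∫_x^{2x} |∑_{M ≤ m < 2M} ∑_{k : t < m²k² ≤ t+y} a_m b_k e(α m²k²)|² dt ≤ C y² L^{−A}, where C depends only on A and c. -/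

import Mathlib

open MeasureTheory

noncomputable section

/-- `e x = exp(2 π i x)`. -/
def e (x : ℝ) : ℂ := Complex.exp (2 * Real.pi * Complex.I * x)

lemma tau_mul_le (d m : ℕ) : (d * m).divisors.card ≤ d.divisors.card * m.divisors.card := by
  rw [Nat.divisors_mul]
  exact Finset.card_mul_le

lemma tau_T (N r : ℕ) :
    ∑ n ∈ Finset.Icc 1 N, ((n.divisors.card : ℝ) ^ r / n) ≤ (1 + Real.log N) ^ (2 ^ r) := by
  induction r with
  | zero =>
    have h := harmonic_le_one_add_log N
    rw [harmonic_eq_sum_Icc] at h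
    push_cast at h
    simpa using h
  | succ r ih =>
    have h0 : 0 ≤ ∑ n ∈ Finset.Icc 1 N, ((n.divisors.card : ℝ) ^ r / n) :=
      Finset.sum_nonneg fun n _ => by positivity
    have key : ∑ n ∈ Finset.Icc 1 N, ((n.divisors.card : ℝ) ^ (r+1) / n) ≤
        (∑ n ∈ Finset.Icc 1 N, ((n.divisors.card : ℝ) ^ r / n)) ^ 2 := by
      rw [sq, Finset.sum_mul_sum, ← Finset.sum_product']
      calc ∑ n ∈ Finset.Icc 1 N, ((n.divisors.card : ℝ) ^ (r+1) / n)
          = ∑ n ∈ Finset.Icc 1 N, ∑ p ∈ n.divisorsAntidiagonal, ((n.divisors.card : ℝ) ^ r / n) := by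
            refine Finset.sum_congr rfl fun n hn => ?_
            rw [Finset.sum_const, nsmul_eq_mul]
            have : n.divisorsAntidiagonal.card = n.divisors.card := by
              rw [← Nat.map_div_right_divisors, Finset.card_map]
            rw [this]; ring
        _ ≤ ∑ n ∈ Finset.Icc 1 N, ∑ p ∈ (Finset.Icc 1 N ×ˢ Finset.Icc 1 N) with p.1 * p.2 = n,
              ((p.1.divisors.card : ℝ) ^ r / p.1 * ((p.2.divisors.card : ℝ) ^ r / p.2)) := by
            refine Finset.sum_le_sum fun n hn => ?_
            rw [Finset.mem_Icc] at hn
            refine le_trans (Finset.sum_le_sum (g := fun p : ℕ × ℕ => ((p.1.divisors.card : ℝ) ^ r / p.1 * ((p.2.divisors.card : ℝ) ^ r / p.2))) ?_) (Finset.sum_le_sum_of_subset_of_nonneg ?_ ?_)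
            · intro p hp
              rw [Nat.mem_divisorsAntidiagonal] at hp
              rw [← hp.1]
              have := tau_mul_le p.1 p.2
              have h2 : ((p.1 * p.2).divisors.card : ℝ) ≤ p.1.divisors.card * p.2.divisors.card := by
                exact_mod_cast this
              push_cast
              rw [div_mul_div_comm, ← mul_pow]
              gcongr
            · intro p hp
              rw [Nat.mem_divisorsAntidiagonal] at hp
              simp only [Finset.mem_filter, Finset.mem_product, Finset.mem_Icc]
              obtain ⟨h1, h2⟩ := hp
              have a1 : 1 ≤ p.1 := Nat.one_le_iff_ne_zero.2 (by rintro h; simp [h] at h1; omega)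
              have a2 : 1 ≤ p.2 := Nat.one_le_iff_ne_zero.2 (by rintro h; simp [h] at h1; omega)
              have a3 : p.1 ≤ n := h1 ▸ Nat.le_mul_of_pos_right _ a2
              have a4 : p.2 ≤ n := h1 ▸ Nat.le_mul_of_pos_left _ a1
              omega
            · intros; positivity
        _ = ∑ p ∈ (Finset.Icc 1 N ×ˢ Finset.Icc 1 N) with p.1 * p.2 ∈ Finset.Icc 1 N,
              ((p.1.divisors.card : ℝ) ^ r / p.1 * ((p.2.divisors.card : ℝ) ^ r / p.2)) := by
            rw [← Finset.sum_fiberwise_of_maps_to (s := Finset.filter (fun p : ℕ × ℕ => p.1 * p.2 ∈ Finset.Icc 1 N) (Finset.Icc 1 N ×ˢ Finset.Icc 1 N)) (t := Finset.Icc 1 N) (g := fun p => p.1 * p.2)]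
            · refine Finset.sum_congr rfl fun n hn => Finset.sum_congr ?_ fun _ _ => rfl
              ext p; simp only [Finset.mem_filter]
              constructor
              · rintro ⟨h, h'⟩; exact ⟨⟨h, h' ▸ hn⟩, h'⟩
              · rintro ⟨⟨h, _⟩, h'⟩; exact ⟨h, h'⟩
            · intro p hp; exact (Finset.mem_filter.1 hp).2
        _ ≤ _ := by
            refine Finset.sum_le_sum_of_subset_of_nonneg (Finset.filter_subset _ _) ?_
            intros; positivity
    refine key.trans ?_
    rw [pow_succ 2 r, pow_mul]
    gcongr

lemma tau_S (N r : ℕ) :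
    ∑ n ∈ Finset.Icc 1 N, ((n.divisors.card : ℝ) ^ r) ≤ N * (1 + Real.log N) ^ (2 ^ r) := by
  refine le_trans ?_ (mul_le_mul_of_nonneg_left (tau_T N r) (Nat.cast_nonneg N))
  rw [Finset.mul_sum]
  refine Finset.sum_le_sum fun n hn => ?_
  rw [Finset.mem_Icc] at hn
  have h1 : (1:ℝ) ≤ n := by exact_mod_cast hn.1
  have h2 : (n:ℝ) ≤ N := by exact_mod_cast hn.2
  rw [mul_div_assoc', le_div_iff₀ (by linarith)]
  rw [mul_comm]
  gcongr

/-- monotone real version -/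
lemma tau_S' (X : ℝ) (hX : 1 ≤ X) (N r : ℕ) (hN : (N:ℝ) ≤ X) :
    ∑ n ∈ Finset.Icc 1 N, ((n.divisors.card : ℝ) ^ r) ≤ X * (1 + Real.log X) ^ (2 ^ r) := by
  refine (tau_S N r).trans ?_
  rcases Nat.eq_zero_or_pos N with h | h
  · subst h
    have := Real.log_nonneg hX
    simp; positivity
  · have h1 : (1:ℝ) ≤ N := by exact_mod_cast h
    have := Real.log_nonneg h1
    gcongr

def phi (R γ : ℝ) : ℝ := R / max 1 (R * |γ - round γ|)

lemma phi_nonneg {R : ℝ} (hR : 0 ≤ R) (γ : ℝ) : 0 ≤ phi R γ := by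
  unfold phi; positivity

lemma phi_le {R : ℝ} (hR : 0 ≤ R) (γ : ℝ) : phi R γ ≤ R := by
  unfold phi; exact div_le_self hR (le_max_left _ _)

lemma e_add (x y : ℝ) : e (x + y) = e x * e y := by
  unfold e; rw [← Complex.exp_add]; congr 1; push_cast; ring

lemma e_int (n : ℤ) : e n = 1 := by
  unfold e
  rw [Complex.exp_eq_one_iff]
  exact ⟨n, by push_cast; ring⟩

lemma norm_e (x : ℝ) : ‖e x‖ = 1 := by
  unfold e
  have : (2 * Real.pi * Complex.I * x : ℂ) = ((2 * Real.pi * x : ℝ) : ℂ) * Complex.I := by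
    push_cast; ring
  rw [this, Complex.norm_exp_ofReal_mul_I]

lemma e_conj (x : ℝ) : (starRingEnd ℂ) (e x) = e (-x) := by
  unfold e
  rw [← Complex.exp_conj]
  congr 1
  simp [Complex.conj_ofNat]

lemma e_sub_one (γ : ℝ) : 4 * |γ - round γ| ≤ ‖e γ - 1‖ := by
  set δ := γ - round γ with hδ
  have h1 : e γ = e δ := by
    have : γ = δ + (round γ : ℤ) := by rw [hδ]; ring
    rw [this, e_add, e_int, mul_one]
  have h2 : e δ = Complex.exp (Complex.I * ((2 * Real.pi * δ : ℝ) : ℂ)) := by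
    unfold e; congr 1; push_cast; ring
  have h3 : |δ| ≤ 1 / 2 := abs_sub_round γ
  rw [h1, h2, Complex.norm_exp_I_mul_ofReal_sub_one]
  have h4 : 2 * Real.pi * δ / 2 = Real.pi * δ := by ring
  rw [h4]
  have h5 := Real.mul_abs_le_abs_sin (x := Real.pi * δ) (by
    rw [abs_mul, abs_of_pos Real.pi_pos]; nlinarith [Real.pi_pos])
  rw [abs_mul, abs_of_pos Real.pi_pos] at h5
  have h6 : 2 / Real.pi * (Real.pi * |δ|) = 2 * |δ| := by
    field_simp
  rw [norm_mul, Real.norm_eq_abs, Real.norm_eq_abs]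
  norm_num
  linarith

lemma geom_tel (γ : ℝ) (u : ℤ) (n : ℕ) :
    (∑ m ∈ Finset.Ico u (u + n), e (γ * m)) * (e γ - 1) = e (γ * (u + n)) - e (γ * u) := by
  induction n with
  | zero => simp
  | succ n ih =>
    have : Finset.Ico u (u + (n+1:ℕ)) = insert (u + (n:ℤ)) (Finset.Ico u (u + n)) := by
      ext z; simp only [Finset.mem_Ico, Finset.mem_insert]; push_cast; omega
    rw [this, Finset.sum_insert (by simp), add_mul, ih]
    push_cast
    have h : e (γ * (u + (n + 1))) = e (γ * (u+n)) * e γ := by rw [← e_add]; congr 1; ring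
    rw [h]; ring

lemma geom_bound (R γ : ℝ) (hR : 0 ≤ R) (u v : ℤ) (h : (v:ℝ) - u ≤ R) :
    ‖∑ m ∈ Finset.Ico u v, e (γ * m)‖ ≤ phi R γ := by
  rcases le_or_gt v u with hvu | huv
  · rw [Finset.Ico_eq_empty (by omega)]; simpa using phi_nonneg hR γ
  obtain ⟨n, rfl⟩ : ∃ n : ℕ, v = u + n := ⟨(v - u).toNat, by omega⟩
  have h1 : ‖∑ m ∈ Finset.Ico u (u+n), e (γ * m)‖ ≤ R := by
    refine (norm_sum_le _ _).trans ?_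
    simp only [norm_e]
    simp
    push_cast at h; linarith
  have h2 := congrArg norm (geom_tel γ u n)
  rw [norm_mul] at h2
  have h3 : ‖e (γ * (u + n)) - e (γ * u)‖ ≤ 2 := by
    refine (norm_sub_le _ _).trans ?_
    rw [norm_e, norm_e]; norm_num
  have h4 := e_sub_one γ
  set S := ‖∑ m ∈ Finset.Ico u (u+n), e (γ * m)‖
  have hS : 0 ≤ S := norm_nonneg _
  have h5 : S * (4 * |γ - round γ|) ≤ 2 := by
    calc _ ≤ S * ‖e γ - 1‖ := by gcongr
      _ ≤ 2 := by rw [h2]; exact h3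
  unfold phi
  rw [le_div_iff₀ (by positivity)]
  rcases max_cases 1 (R * |γ - round γ|) with ⟨hm, _⟩ | ⟨hm, _⟩ <;> rw [hm]
  · linarith
  · nlinarith

lemma weyl (R β : ℝ) (hR : 0 ≤ R) (Rn : ℕ) (hRn : (Rn : ℝ) ≤ R) (u v : ℤ) (h : v - u ≤ Rn) :
    ‖∑ m ∈ Finset.Ico u v, e (β * (m:ℝ) ^ 2)‖ ^ 2 ≤
      ∑ h ∈ Finset.Ioo (-(Rn : ℤ)) Rn, phi R (2 * β * h) := by
  have h1 : ((‖∑ m ∈ Finset.Ico u v, e (β * (m:ℝ) ^ 2)‖ ^ 2 : ℝ) : ℂ) =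
      ∑ h ∈ Finset.Ioo (-(Rn : ℤ)) Rn, e (β * (h:ℝ)^2) * ∑ m ∈ Finset.Ico (max u (u-h)) (min v (v-h)), e (2 * β * h * m) := by
    rw [Complex.ofReal_pow, ← Complex.conj_mul', map_sum, Finset.sum_mul_sum]
    simp only [e_conj, ← e_add]
    have : ∀ h ∈ Finset.Ioo (-(Rn : ℤ)) Rn, e (β * (h:ℝ)^2) * ∑ m ∈ Finset.Ico (max u (u-h)) (min v (v-h)), e (2 * β * h * m) = ∑ m ∈ Finset.Ico u v, if m + h ∈ Finset.Ico u v then e (-(β * (m:ℝ)^2) + β * ((m + h : ℤ):ℝ)^2) else 0 := by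
      intro h hh
      rw [← Finset.sum_filter, Finset.mul_sum]
      refine Finset.sum_congr ?_ ?_
      · ext m; simp only [Finset.mem_Ico, Finset.mem_filter]; omega
      · intro m _
        rw [← e_add]; congr 1; push_cast; ring
    refine Eq.trans ?_ (Finset.sum_congr rfl this).symm
    rw [Finset.sum_comm (s := Finset.Ioo (-(Rn : ℤ)) Rn)]
    refine Finset.sum_congr rfl fun m hm => ?_
    rw [← Finset.sum_filter]
    refine Finset.sum_bij' (fun i _ => i - m) (fun i _ => m + i) ?_ ?_ ?_ ?_ ?_
    · intro a ha
      simp only [Finset.mem_Ico, Finset.mem_filter, Finset.mem_Ioo] at *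
      omega
    · intro a ha
      simp only [Finset.mem_Ico, Finset.mem_filter, Finset.mem_Ioo] at *
      omega
    · intros; ring
    · intros; ring
    · intro a _
      congr 1
      push_cast; ring
  have h2 : ‖∑ m ∈ Finset.Ico u v, e (β * (m:ℝ) ^ 2)‖ ^ 2 = ‖∑ h ∈ Finset.Ioo (-(Rn : ℤ)) Rn, e (β * (h:ℝ)^2) * ∑ m ∈ Finset.Ico (max u (u-h)) (min v (v-h)), e (2 * β * h * m)‖ := by
    rw [← h1, Complex.norm_real, Real.norm_eq_abs, abs_of_nonneg (by positivity)]
  rw [h2]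
  refine (norm_sum_le _ _).trans (Finset.sum_le_sum fun h hh => ?_)
  rw [norm_mul, norm_e, one_mul]
  refine geom_bound R _ hR _ _ ?_
  have : min v (v-h) - max u (u - h) ≤ Rn := by omega
  have : ((min v (v-h) - max u (u - h) : ℤ) : ℝ) ≤ Rn := by exact_mod_cast this
  push_cast at *
  linarith

lemma sep (α : ℝ) (a : ℤ) (q : ℕ) (hq : 1 ≤ q) (hg : Int.gcd a q = 1)
    (hα : |α - (a : ℝ) / (q : ℝ)| < 1 / (q : ℝ) ^ 2) (d l : ℤ) (hd : d ≠ 0) (hd2 : 2 * |d| ≤ q) :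
    1 / (2 * (q:ℝ)) ≤ |α * d - l| := by
  have hq0 : (0:ℝ) < q := by exact_mod_cast hq
  have hne : a * d - l * q ≠ 0 := by
    intro h
    have h1 : (q:ℤ) ∣ a * d := ⟨l, by linarith⟩
    have h2 : IsCoprime (q:ℤ) a := (Int.isCoprime_iff_gcd_eq_one.2 hg).symm
    have h3 : (q:ℤ) ∣ d := h2.dvd_of_dvd_mul_left h1
    have h4 := Int.le_of_dvd (abs_pos.2 hd) ((dvd_abs _ _).2 h3)
    have := abs_pos.2 hd
    omega
  have h1 : (1:ℝ) ≤ |(a:ℝ) * d - l * q| := by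
    have := Int.one_le_abs hne
    exact_mod_cast this
  have h2 : (a:ℝ) * d - l * q = q * ((α * d - l) - (α - a / q) * d) := by
    field_simp; ring
  rw [h2, abs_mul, abs_of_pos hq0] at h1
  have h3 : |(α * d - l) - (α - a / q) * d| ≤ |α * d - l| + 1 / (q:ℝ)^2 * |(d:ℝ)| := by
    refine (abs_sub _ _).trans ?_
    rw [abs_mul (α - a/q)]
    gcongr
  have h4 : 2 * |(d:ℝ)| ≤ q := by exact_mod_cast hd2
  have h5 : 1 / (q:ℝ)^2 * |(d:ℝ)| ≤ 1 / (2 * q) := by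
    rw [div_mul_eq_mul_div, one_mul, div_le_div_iff₀ (by positivity) (by positivity)]
    nlinarith
  have h6 : 1 / (q:ℝ) ≤ |(α * d - l) - (α - a / q) * d| := by
    rw [div_le_iff₀ hq0]; linarith
  have h7 : 1 / (q:ℝ) = 1 / (2 * q) + 1 / (2*q) := by field_simp; norm_num
  linarith

def psi (R : ℝ) (q j : ℕ) : ℝ := R / max 1 (R * (j / (2 * q)))

lemma psi_nonneg {R : ℝ} (hR : 0 ≤ R) (q j : ℕ) : 0 ≤ psi R q j := by
  unfold psi; positivity

lemma psi_sum (R : ℝ) (hR : 0 < R) (q : ℕ) (hq : 1 ≤ q) :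
    ∑ j ∈ Finset.range (2 * q), psi R q j ≤ R + 2 * q * (1 + Real.log (2 * q)) := by
  have hq0 : (0:ℝ) < q := by exact_mod_cast hq
  have hsub : Finset.range (2 * q) ⊆ insert 0 (Finset.Icc 1 (2*q)) := by
    intro j hj; simp at *; omega
  refine (Finset.sum_le_sum_of_subset_of_nonneg hsub fun j _ _ => psi_nonneg hR.le q j).trans ?_
  rw [Finset.sum_insert (by simp)]
  have h := harmonic_le_one_add_log (2 * q)
  rw [harmonic_eq_sum_Icc] at h
  push_cast at h
  refine add_le_add (by simp [psi]) ?_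
  refine le_trans ?_ (mul_le_mul_of_nonneg_left h (by positivity))
  rw [Finset.mul_sum]
  refine Finset.sum_le_sum fun j hj => ?_
  have hj1 : (1:ℝ) ≤ j := by exact_mod_cast (Finset.mem_Icc.1 hj).1
  unfold psi
  refine (div_le_div_of_nonneg_left hR.le (by positivity) (le_max_right _ _)).trans ?_
  apply le_of_eq
  field_simp

lemma phi_block (α : ℝ) (a : ℤ) (q : ℕ) (hq : 1 ≤ q) (hg : Int.gcd a q = 1)
    (hα : |α - (a : ℝ) / (q : ℝ)| < 1 / (q : ℝ) ^ 2) (R : ℝ) (hR : 0 < R) (n0 P : ℕ)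
    (hP : 2 * P ≤ q + 2) :
    ∑ i ∈ Finset.range P, phi R (α * ((n0 + i : ℕ) : ℝ)) ≤ 2 * R + 4 * q * (1 + Real.log (2 * q)) := by
  have hq0 : (0:ℝ) < q := by exact_mod_cast hq
  set g : ℕ → ℕ := fun i => ⌊2 * q * Int.fract (α * ((n0 + i : ℕ) : ℝ))⌋₊ with hgdef
  have g1 : ∀ i, (g i : ℝ) ≤ 2 * q * Int.fract (α * ((n0 + i : ℕ) : ℝ)) := fun i =>
    Nat.floor_le (by have := Int.fract_nonneg (α * ((n0 + i : ℕ) : ℝ)); positivity)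
  have g2 : ∀ i, 2 * q * Int.fract (α * ((n0 + i : ℕ) : ℝ)) < g i + 1 := fun i =>
    Nat.lt_floor_add_one _
  have g3 : ∀ i, g i < 2 * q := by
    intro i
    have h1 := g1 i
    have h2 := Int.fract_lt_one (α * ((n0 + i : ℕ) : ℝ))
    have : (g i : ℝ) < (2 * q : ℕ) := by push_cast; nlinarith
    exact_mod_cast this
  have ginj : Set.InjOn g (Finset.range P) := by
    intro i hi j hj hij
    by_contra hne
    have hi' := Finset.mem_range.1 hi
    have hj' := Finset.mem_range.1 hj
    have hs := sep α a q hq hg hα ((i:ℤ) - j) (⌊α * ((n0 + i : ℕ) : ℝ)⌋ - ⌊α * ((n0 + j : ℕ) : ℝ)⌋)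
      (by omega) (by rcases abs_cases ((i:ℤ) - j) with h | h <;> omega)
    have e1 : α * (((i:ℤ) - j : ℤ):ℝ) - ((⌊α * ((n0 + i : ℕ) : ℝ)⌋ - ⌊α * ((n0 + j : ℕ) : ℝ)⌋ : ℤ) : ℝ)
        = Int.fract (α * ((n0 + i : ℕ) : ℝ)) - Int.fract (α * ((n0 + j : ℕ) : ℝ)) := by
      unfold Int.fract; push_cast; ring
    rw [e1, div_le_iff₀ (by positivity)] at hs
    have a1 := g1 i
    have a2 := g2 i
    have a3 := g1 j
    have a4 := g2 j
    rw [hij] at a1 a2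
    rcases abs_cases (Int.fract (α * ((n0 + i : ℕ) : ℝ)) - Int.fract (α * ((n0 + j : ℕ) : ℝ))) with h | h <;> nlinarith
  have hb : ∀ i, phi R (α * ((n0 + i : ℕ) : ℝ)) ≤ psi R q (g i) + psi R q (2 * q - 1 - g i) := by
    intro i
    have hn1 := psi_nonneg hR.le q (g i)
    have hn2 := psi_nonneg hR.le q (2 * q - 1 - g i)
    have a1 := g1 i
    have a2 := g2 i
    have a3 := g3 i
    unfold phi
    rw [abs_sub_round_eq_min]
    rcases min_cases (Int.fract (α * ((n0 + i : ℕ) : ℝ))) (1 - Int.fract (α * ((n0 + i : ℕ) : ℝ))) with ⟨h, _⟩ | ⟨h, _⟩ <;> rw [h]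
    · refine le_trans ?_ (le_add_of_nonneg_right hn2)
      unfold psi
      gcongr
      rw [div_le_iff₀ (by positivity)]; linarith
    · refine le_trans ?_ (le_add_of_nonneg_left hn1)
      unfold psi
      gcongr
      rw [div_le_iff₀ (by positivity)]
      have : ((2 * q - 1 - g i : ℕ) : ℝ) = 2 * q - 1 - g i := by
        rw [Nat.cast_sub (by omega), Nat.cast_sub (by omega)]; push_cast; ring
      rw [this]; linarith
  calc _ ≤ ∑ i ∈ Finset.range P, (psi R q (g i) + psi R q (2 * q - 1 - g i)) :=
        Finset.sum_le_sum fun i _ => hb i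
    _ = ∑ j ∈ (Finset.range P).image g, (psi R q j + psi R q (2 * q - 1 - j)) := by
        rw [Finset.sum_image ginj]
    _ ≤ ∑ j ∈ Finset.range (2 * q), (psi R q j + psi R q (2 * q - 1 - j)) := by
        refine Finset.sum_le_sum_of_subset_of_nonneg ?_ fun j _ _ => add_nonneg (psi_nonneg hR.le _ _) (psi_nonneg hR.le _ _)
        intro j hj
        obtain ⟨i, _, rfl⟩ := Finset.mem_image.1 hj
        exact Finset.mem_range.2 (g3 i)
    _ = 2 * ∑ j ∈ Finset.range (2 * q), psi R q j := by
        rw [Finset.sum_add_distrib, Finset.sum_range_reflect (psi R q) (2*q)]; ring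
    _ ≤ _ := by have := psi_sum R hR q hq; linarith

lemma phi_sum (α : ℝ) (a : ℤ) (q : ℕ) (hq : 1 ≤ q) (hg : Int.gcd a q = 1)
    (hα : |α - (a : ℝ) / (q : ℝ)| < 1 / (q : ℝ) ^ 2) (R : ℝ) (hR : 0 < R) (N : ℕ) :
    ∑ n ∈ Finset.Icc 1 N, phi R (α * (n : ℝ)) ≤
      (2 * N / q + 1) * (2 * R + 4 * q * (1 + Real.log (2 * q))) := by
  have hq0 : (0:ℝ) < q := by exact_mod_cast hq
  set P := q / 2 + 1 with hPdef
  have hP : 2 * P ≤ q + 2 := by omega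
  set T := 2 * R + 4 * q * (1 + Real.log (2 * q)) with hT
  have hq1 : (1:ℝ) ≤ q := by exact_mod_cast hq
  have hT0 : 0 ≤ T := by
    have := Real.log_nonneg (x := 2 * q) (by linarith)
    positivity
  have hblocks : ∀ Q : ℕ, ∑ n ∈ Finset.range (P * Q), phi R (α * (n : ℝ)) ≤ Q * T := by
    intro Q
    induction Q with
    | zero => simp
    | succ Q ih =>
      rw [Nat.mul_succ, Finset.sum_range_add]
      have := phi_block α a q hq hg hα R hR (P * Q) P hP
      push_cast at *
      linarith
  have hsub : Finset.Icc 1 N ⊆ Finset.range (P * (N / P + 1)) := by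
    intro n hn
    have := (Finset.mem_Icc.1 hn).2
    have h2 : N < P * (N / P + 1) := Nat.lt_mul_div_succ N (by omega)
    exact Finset.mem_range.2 (by omega)
  refine (Finset.sum_le_sum_of_subset_of_nonneg hsub fun j _ _ => phi_nonneg hR.le _).trans ?_
  refine (hblocks _).trans ?_
  refine mul_le_mul_of_nonneg_right ?_ hT0
  push_cast
  have h1 : ((N / P : ℕ) : ℝ) ≤ N / P := Nat.cast_div_le
  have h2 : (q:ℝ) ≤ 2 * P := by
    have : q ≤ 2 * P := by omega
    exact_mod_cast this
  have h3 : (N:ℝ) / P ≤ 2 * N / q := by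
    rw [div_le_div_iff₀ (by positivity) hq0]
    nlinarith [Nat.cast_nonneg (α := ℝ) N]
  linarith

lemma phi_neg (R γ : ℝ) : phi R (-γ) = phi R γ := by
  unfold phi
  congr 3
  rw [abs_sub_round_eq_min, abs_sub_round_eq_min]
  by_cases h : Int.fract γ = 0
  · rw [Int.fract_neg_eq_zero.2 h, h]
  · rw [Int.fract_neg h, sub_sub_cancel, min_comm]

lemma phi_natAbs (R α : ℝ) (n : ℤ) : phi R (α * (n.natAbs : ℝ)) = phi R (α * n) := by
  have : (n.natAbs : ℝ) = |(n:ℝ)| := by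
    rw [Nat.cast_natAbs, Int.cast_abs]
  rw [this]
  rcases abs_cases (n:ℝ) with ⟨h, _⟩ | ⟨h, _⟩ <;> rw [h]
  rw [mul_neg, phi_neg]

def pairs (K : ℕ) (J : ℝ) : Finset (ℕ × ℕ) :=
  (Finset.Icc 1 K ×ˢ Finset.Icc 1 K).filter (fun p => |(p.1 : ℝ) - p.2| ≤ J)

lemma pair_sum (K : ℕ) (J : ℝ) (hJ : 0 ≤ J) (w : ℕ → ℝ) (hw : ∀ k, 0 ≤ w k) :
    ∑ p ∈ pairs K J, w p.1 ≤ (2 * J + 1) * ∑ k ∈ Finset.Icc 1 K, w k := by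
  unfold pairs
  rw [Finset.sum_filter, Finset.sum_product, Finset.mul_sum]
  refine Finset.sum_le_sum fun k hk => ?_
  simp only
  rw [← Finset.sum_filter, Finset.sum_const, nsmul_eq_mul]
  refine mul_le_mul_of_nonneg_right ?_ (hw k)
  have h1 : ((Finset.Icc 1 K).filter (fun j : ℕ => |(k : ℝ) - j| ≤ J)).card ≤
      (Finset.Icc (-⌊J⌋) ⌊J⌋).card := by
    refine Finset.card_le_card_of_injOn (fun j => (k:ℤ) - j) ?_ ?_
    · intro j hj
      have hj := (Finset.mem_filter.1 hj).2
      simp only [Finset.coe_Icc, Set.mem_Icc]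
      rw [abs_le] at hj
      constructor
      · rw [neg_le, Int.le_floor]; push_cast; linarith
      · rw [Int.le_floor]; push_cast; linarith
    · intro i _ j _ h
      simp only at h
      omega
  rw [Int.card_Icc] at h1
  have h2 : (((⌊J⌋ + 1 - -⌊J⌋).toNat : ℕ) : ℝ) ≤ 2 * J + 1 := by
    have h0 : 0 ≤ ⌊J⌋ := Int.floor_nonneg.2 hJ
    have : (((⌊J⌋ + 1 - -⌊J⌋).toNat : ℤ) : ℝ) = ((⌊J⌋ + 1 - -⌊J⌋ : ℤ) : ℝ) := by
      rw [Int.toNat_of_nonneg (by omega)]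
    have h3 := Int.floor_le J
    push_cast at this
    rw [this]; linarith
  exact le_trans (by exact_mod_cast h1) h2

lemma pair_sum2 (K : ℕ) (J : ℝ) (hJ : 0 ≤ J) (w : ℕ → ℝ) (hw : ∀ k, 0 ≤ w k) :
    ∑ p ∈ pairs K J, w p.2 ≤ (2 * J + 1) * ∑ k ∈ Finset.Icc 1 K, w k := by
  refine le_trans (le_of_eq ?_) (pair_sum K J hJ w hw)
  refine Finset.sum_bij' (fun p _ => (p.2, p.1)) (fun p _ => (p.2, p.1)) ?_ ?_ ?_ ?_ ?_
  · intro p hp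
    simp only [pairs, Finset.mem_filter, Finset.mem_product] at *
    rw [abs_sub_comm]; tauto
  · intro p hp
    simp only [pairs, Finset.mem_filter, Finset.mem_product] at *
    rw [abs_sub_comm]; tauto
  · intros; rfl
  · intros; rfl
  · intros; rfl

def nu (x : (ℕ × ℕ) × ℤ) : ℕ := (2 * ((x.1.1 : ℤ) ^ 2 - (x.1.2:ℤ) ^ 2) * x.2).natAbs

lemma nu_eq (x : (ℕ × ℕ) × ℤ) :
    nu x = 2 * (((x.1.1 : ℤ) - x.1.2).natAbs * (x.1.1 + x.1.2)) * x.2.natAbs := by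
  unfold nu
  rw [sq_sub_sq, Int.natAbs_mul, Int.natAbs_mul, Int.natAbs_mul]
  have : ((x.1.1 : ℤ) + x.1.2).natAbs = x.1.1 + x.1.2 := by omega
  rw [this]
  rw [show (2:ℤ).natAbs = 2 from rfl]; ring

lemma nu_fiber (X : Finset ((ℕ × ℕ) × ℤ)) (n : ℕ) (hn : n ≠ 0) :
    (X.filter (fun x => nu x = n)).card ≤ 4 * n.divisors.card ^ 2 := by
  have h : (X.filter (fun x => nu x = n)).card ≤
      ((n.divisors ×ˢ n.divisors) ×ˢ ((Finset.univ : Finset Bool) ×ˢ (Finset.univ : Finset Bool))).card := by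
    refine Finset.card_le_card_of_injOn
      (fun x => ((((x.1.1 : ℤ) - x.1.2).natAbs, x.2.natAbs),
        (decide (x.1.1 ≤ x.1.2), decide (0 ≤ x.2)))) ?_ ?_
    · intro x hx
      have hx := (Finset.mem_filter.1 hx).2
      rw [nu_eq] at hx
      simp only [Finset.coe_product, Set.mem_prod, Finset.mem_coe, Nat.mem_divisors, Finset.mem_univ, and_true]
      refine ⟨⟨?_, hn⟩, ?_, hn⟩
      · rw [← hx]; exact ⟨2 * (x.1.1 + x.1.2) * x.2.natAbs, by ring⟩
      · rw [← hx]; exact Dvd.intro_left _ rfl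
    · rintro ⟨⟨a, b⟩, h⟩ hx ⟨⟨a', b'⟩, h'⟩ hx' heq
      have hx := (Finset.mem_filter.1 hx).2
      have hx' := (Finset.mem_filter.1 hx').2
      rw [nu_eq] at hx hx'
      simp only [Prod.mk.injEq, decide_eq_decide] at heq hx hx'
      obtain ⟨⟨h1, h2⟩, h3, h4⟩ := heq
      rw [← h1, ← h2] at hx'
      have hj : ((a:ℤ) - b).natAbs ≠ 0 := by rintro h; rw [h] at hx; simp at hx; omega
      have hh : h.natAbs ≠ 0 := by rintro h; rw [h] at hx; simp at hx; omega
      have hs : a + b = a' + b' := by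
        rw [← hx'] at hx
        have := Nat.eq_of_mul_eq_mul_right (Nat.pos_of_ne_zero hh) hx
        have := Nat.eq_of_mul_eq_mul_left (by norm_num) this
        exact Nat.eq_of_mul_eq_mul_left (Nat.pos_of_ne_zero hj) this
      have : h = h' := by omega
      have : a = a' := by omega
      have : b = b' := by omega
      simp_all
  refine h.trans (le_of_eq ?_)
  simp [Finset.card_product]; ring

lemma Phi_bound (α R J : ℝ) (hR : 0 ≤ R) (K Rn N : ℕ)
    (hN : ∀ p ∈ pairs K J, ∀ h ∈ Finset.Ioo (-(Rn : ℤ)) Rn, nu (p, h) ≤ N) :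
    ∑ p ∈ pairs K J, ∑ h ∈ Finset.Ioo (-(Rn : ℤ)) Rn, phi R (2 * (α * ((p.1:ℝ)^2 - (p.2:ℝ)^2)) * h)
      ≤ R * ((pairs K J).card + 2 * K * Rn) +
        4 * ∑ n ∈ Finset.Icc 1 N, (n.divisors.card : ℝ) ^ 2 * phi R (α * n) := by
  set X := pairs K J ×ˢ Finset.Ioo (-(Rn : ℤ)) Rn with hX
  have h1 : ∑ p ∈ pairs K J, ∑ h ∈ Finset.Ioo (-(Rn : ℤ)) Rn, phi R (2 * (α * ((p.1:ℝ)^2 - (p.2:ℝ)^2)) * h)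
      = ∑ x ∈ X, phi R (α * (nu x : ℝ)) := by
    rw [hX, Finset.sum_product]
    refine Finset.sum_congr rfl fun p _ => Finset.sum_congr rfl fun h _ => ?_
    unfold nu
    rw [phi_natAbs]
    congr 1
    push_cast; ring
  rw [h1, ← Finset.sum_filter_add_sum_filter_not X (fun x => nu x = 0)]
  refine add_le_add ?_ ?_
  · have hc : (X.filter (fun x => nu x = 0)).card ≤ (pairs K J).card + 2 * K * Rn := by
      have hsub : X.filter (fun x => nu x = 0) ⊆ (pairs K J ×ˢ {0}) ∪
          (Finset.Icc 1 K ×ˢ Finset.Ioo (-(Rn : ℤ)) Rn).image (fun z => ((z.1, z.1), z.2)) := by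
        rintro ⟨⟨a, b⟩, h⟩ hx
        obtain ⟨hx1, hx2⟩ := Finset.mem_filter.1 hx
        obtain ⟨hx3, hx4⟩ := Finset.mem_product.1 hx1
        rw [nu_eq] at hx2
        simp only [Nat.mul_eq_zero, Int.natAbs_eq_zero] at hx2
        have hab : 1 ≤ a ∧ a ≤ K := by
          have := (Finset.mem_filter.1 hx3).1
          simpa using (Finset.mem_product.1 this).1
        rcases hx2 with (h0 | h0 | h0) | h0
        · omega
        · have : a = b := by omega
          subst this
          refine Finset.mem_union_right _ (Finset.mem_image.2 ⟨(a, h), ?_, rfl⟩)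
          simp only [Finset.mem_product, Finset.mem_Icc]
          exact ⟨hab, hx4⟩
        · omega
        · refine Finset.mem_union_left _ (Finset.mem_product.2 ⟨hx3, by simpa using h0⟩)
      refine (Finset.card_le_card hsub).trans ((Finset.card_union_le _ _).trans ?_)
      refine add_le_add (by simp) (Finset.card_image_le.trans ?_)
      rw [Finset.card_product, Nat.card_Icc, Int.card_Ioo]
      have : ((Rn:ℤ) - -Rn - 1).toNat ≤ 2 * Rn := by omega
      calc _ ≤ K * (2 * Rn) := by gcongr; omega
        _ = _ := by ring
    refine (Finset.sum_le_card_nsmul _ _ R fun x _ => phi_le hR _).trans ?_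
    rw [nsmul_eq_mul, mul_comm]
    refine mul_le_mul_of_nonneg_left ?_ hR
    exact_mod_cast hc
  · rw [← Finset.sum_fiberwise_of_maps_to (s := X.filter (fun x => ¬ nu x = 0)) (t := Finset.Icc 1 N) (g := nu), Finset.mul_sum]
    · refine Finset.sum_le_sum fun n hn => ?_
      have hn1 := (Finset.mem_Icc.1 hn).1
      rw [Finset.sum_congr rfl (g := fun _ => phi R (α * n)) (by
        intro x hx; rw [(Finset.mem_filter.1 hx).2]), Finset.sum_const, nsmul_eq_mul, ← mul_assoc]
      refine mul_le_mul_of_nonneg_right ?_ (phi_nonneg hR _)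
      exact_mod_cast nu_fiber _ n (by omega)
    · rintro ⟨p, h⟩ hx
      obtain ⟨hx1, hx2⟩ := Finset.mem_filter.1 hx
      obtain ⟨hx3, hx4⟩ := Finset.mem_product.1 hx1
      have := hN p hx3 h hx4
      exact Finset.mem_Icc.2 ⟨by omega, this⟩

lemma cs_tau (α R : ℝ) (hR : 0 ≤ R) (N : ℕ) :
    (∑ n ∈ Finset.Icc 1 N, (n.divisors.card : ℝ) ^ 2 * phi R (α * n)) ^ 2 ≤
      (R * ∑ n ∈ Finset.Icc 1 N, (n.divisors.card : ℝ) ^ 4) * ∑ n ∈ Finset.Icc 1 N, phi R (α * n) := by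
  have h := Finset.sum_sq_le_sum_mul_sum_of_sq_le_mul (Finset.Icc 1 N)
    (r := fun n : ℕ => (n.divisors.card : ℝ) ^ 2 * phi R (α * n))
    (f := fun n : ℕ => (n.divisors.card : ℝ) ^ 4 * phi R (α * n))
    (g := fun n : ℕ => phi R (α * n))
    (fun n _ => mul_nonneg (by positivity) (phi_nonneg hR _)) (fun n _ => phi_nonneg hR _)
    (fun n _ => le_of_eq (by ring))
  refine h.trans ?_
  refine mul_le_mul_of_nonneg_right ?_ (Finset.sum_nonneg fun n _ => phi_nonneg hR _)
  rw [Finset.mul_sum]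
  refine Finset.sum_le_sum fun n _ => ?_
  rw [mul_comm]
  exact mul_le_mul_of_nonneg_right (phi_le hR _) (by positivity)

def ind (y n t : ℝ) : ℝ := if t < n ∧ n ≤ t + y then 1 else 0

lemma ind_mul (y n₁ n₂ t : ℝ) : ind y n₁ t * ind y n₂ t =
    (Set.Ico (max (n₁ - y) (n₂ - y)) (min n₁ n₂)).indicator (fun _ => (1:ℝ)) t := by
  unfold ind
  rw [Set.indicator_apply, ite_zero_mul_ite_zero, one_mul]
  refine if_congr ?_ rfl rfl
  rw [Set.mem_Ico, max_le_iff, lt_min_iff]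
  constructor
  · rintro ⟨⟨h1, h2⟩, h3, h4⟩; exact ⟨⟨by linarith, by linarith⟩, h1, h3⟩
  · rintro ⟨⟨h1, h2⟩, h3, h4⟩; exact ⟨⟨h3, by linarith⟩, h4, by linarith⟩

lemma ind_intervalIntegrable (l u a b : ℝ) :
    IntervalIntegrable ((Set.Ico l u).indicator (fun _ => (1:ℝ))) volume a b := by
  have h : IntervalIntegrable (fun _ => (1:ℝ)) volume a b := intervalIntegrable_const
  exact ⟨h.1.indicator measurableSet_Ico, h.2.indicator measurableSet_Ico⟩

lemma ind_intervalIntegrable_c (l u a b : ℝ) :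
    IntervalIntegrable (fun t => (((Set.Ico l u).indicator (fun _ => (1:ℝ)) t : ℝ) : ℂ)) volume a b :=
  ⟨(ind_intervalIntegrable l u a b).1.ofReal, (ind_intervalIntegrable l u a b).2.ofReal⟩

lemma ind_integral (l u a b : ℝ) (hab : a ≤ b) :
    ∫ t in a..b, (Set.Ico l u).indicator (fun _ => (1:ℝ)) t = max (min u b - max l a) 0 := by
  rw [intervalIntegral.integral_of_le hab, ← integral_Ico_eq_integral_Ioc,
    integral_indicator measurableSet_Ico, Measure.restrict_restrict measurableSet_Ico,
    Set.Ico_inter_Ico]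
  simp [Real.volume_real_Ico]

lemma layer (S : Finset ℕ) (f : ℕ → ℝ) (Y Bd : ℝ) (hY : 0 ≤ Y) (hf : ∀ m ∈ S, f m ≤ Y)
    (z : ℕ → ℂ) (hB : ∀ s : ℝ, 0 ≤ s → ‖∑ m ∈ S.filter (fun m => s < f m), z m‖ ≤ Bd) :
    ‖∑ m ∈ S, ((max (f m) 0 : ℝ) : ℂ) * z m‖ ≤ Y * Bd := by
  have h1 : ∀ m ∈ S, ((max (f m) 0 : ℝ) : ℂ) * z m =
      ∫ s in (0:ℝ)..Y, (((Set.Ico 0 (f m)).indicator (fun _ => (1:ℝ)) s : ℝ) : ℂ) * z m := by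
    intro m hm
    rw [intervalIntegral.integral_mul_const, intervalIntegral.integral_ofReal,
      ind_integral _ _ _ _ hY, min_eq_left (hf m hm)]
    simp
  rw [Finset.sum_congr rfl h1, ← intervalIntegral.integral_finsetSum]
  · refine (intervalIntegral.norm_integral_le_of_norm_le_const (C := Bd) ?_).trans (le_of_eq ?_)
    · intro s hs
      rw [Set.uIoc_of_le hY] at hs
      refine le_trans (le_of_eq ?_) (hB s hs.1.le)
      rw [Finset.sum_filter]
      congr 1
      refine Finset.sum_congr rfl fun m _ => ?_
      rw [Set.indicator_apply]
      by_cases h : s < f m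
      · rw [if_pos ⟨hs.1.le, h⟩, if_pos h]; simp
      · rw [if_neg (fun h' => h h'.2), if_neg h]; simp
    · rw [sub_zero, abs_of_nonneg hY, mul_comm]
  · intro m _
    exact (ind_intervalIntegrable_c _ _ _ _).mul_const _

lemma interval_bound (M β : ℝ) (hM : 1 ≤ M) (S : Finset ℕ) (hS : ∀ m ∈ S, M ≤ (m:ℝ) ∧ (m:ℝ) < 2 * M)
    (hc : ∀ m₁ ∈ S, ∀ m₂ ∈ S, ∀ m, m₁ ≤ m → m ≤ m₂ → m ∈ S) :
    ‖∑ m ∈ S, e (β * (m:ℝ) ^ 2)‖ ^ 2 ≤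
      ∑ h ∈ Finset.Ioo (-((⌊M⌋₊ + 1 : ℕ) : ℤ)) (⌊M⌋₊ + 1 : ℕ), phi (2 * M) (2 * β * h) := by
  rcases S.eq_empty_or_nonempty with rfl | hne
  · simp
    exact Finset.sum_nonneg fun _ _ => phi_nonneg (by linarith) _
  have hmin := S.min'_mem hne
  have hmax := S.max'_mem hne
  set u := S.min' hne
  set v := S.max' hne
  have hSe : ∀ m, m ∈ S ↔ u ≤ m ∧ m ≤ v := fun m =>
    ⟨fun h => ⟨S.min'_le m h, S.le_max' m h⟩, fun h => hc u hmin v hmax m h.1 h.2⟩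
  have h1 : ∑ m ∈ S, e (β * (m:ℝ) ^ 2) = ∑ m ∈ Finset.Ico (u:ℤ) (v + 1), e (β * (m:ℝ) ^ 2) := by
    refine Finset.sum_bij' (fun m _ => (m:ℤ)) (fun m _ => m.toNat) ?_ ?_ ?_ ?_ ?_
    · intro m hm; rw [hSe] at hm; rw [Finset.mem_Ico]; omega
    · intro m hm; rw [Finset.mem_Ico] at hm; rw [hSe]; omega
    · intro m _; simp
    · intro m hm; rw [Finset.mem_Ico] at hm; omega
    · intro m _; simp
  rw [h1]
  refine weyl (2 * M) β (by linarith) _ ?_ _ _ ?_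
  · push_cast
    have := Nat.floor_le (a := M) (by linarith)
    linarith
  · have a1 := (hS u hmin).1
    have a2 := (hS v hmax).2
    have a3 := Nat.lt_floor_add_one M
    have : (v:ℝ) < (u + ⌊M⌋₊ + 1 : ℕ) := by push_cast; linarith
    have : v < u + ⌊M⌋₊ + 1 := by exact_mod_cast this
    push_cast; omega

lemma affine_between (c d s u₁ u₂ u : ℝ) (h1 : s < c * u₁ + d) (h2 : s < c * u₂ + d)
    (hu1 : u₁ ≤ u) (hu2 : u ≤ u₂) : s < c * u + d := by
  rcases le_total 0 c with h | h <;> nlinarith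

def ff (x y n₁ n₂ : ℝ) : ℝ := min (min n₁ n₂) (2 * x) - max (max (n₁ - y) (n₂ - y)) x

lemma lt_ff (x y n₁ n₂ s : ℝ) : s < ff x y n₁ n₂ ↔
    (s < y ∧ s < n₁ - n₂ + y ∧ s < n₁ - x) ∧ (s < n₂ - n₁ + y ∧ s < y ∧ s < n₂ - x) ∧
    (s < 2 * x - n₁ + y ∧ s < 2 * x - n₂ + y ∧ s < x) := by
  unfold ff
  rw [lt_sub_comm, max_lt_iff, max_lt_iff, lt_sub_comm, lt_sub_comm (b := min _ _), lt_sub_comm (b := min _ _)]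
  rw [lt_sub_iff_add_lt, lt_sub_iff_add_lt, lt_sub_iff_add_lt]
  simp only [lt_min_iff]
  constructor
  · rintro ⟨⟨⟨⟨a1, a2⟩, a3⟩, ⟨a4, a5⟩, a6⟩, ⟨a7, a8⟩, a9⟩
    refine ⟨⟨?_, ?_, ?_⟩, ⟨?_, ?_, ?_⟩, ?_, ?_, ?_⟩ <;> linarith
  · rintro ⟨⟨a1, a2, a3⟩, ⟨a4, a5, a6⟩, a7, a8, a9⟩
    refine ⟨⟨⟨⟨?_, ?_⟩, ?_⟩, ⟨?_, ?_⟩, ?_⟩, ⟨?_, ?_⟩, ?_⟩ <;> linarith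

def Mset (M : ℝ) (N : ℕ) : Finset ℕ := (Finset.Icc 1 N).filter (fun m => M ≤ (m:ℝ) ∧ (m:ℝ) < 2 * M)

lemma S_bound (x y M α : ℝ) (hy : 0 ≤ y) (hM : 1 ≤ M) (N k₁ k₂ : ℕ) :
    ‖∑ m ∈ Mset M N, ((max (ff x y (((m:ℝ) * k₁) ^ 2) (((m:ℝ) * k₂) ^ 2)) 0 : ℝ) : ℂ) *
        e (α * ((k₁:ℝ)^2 - (k₂:ℝ) ^ 2) * (m:ℝ) ^ 2)‖ ≤
      y * √(∑ h ∈ Finset.Ioo (-((⌊M⌋₊ + 1 : ℕ) : ℤ)) (⌊M⌋₊ + 1 : ℕ),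
        phi (2 * M) (2 * (α * ((k₁:ℝ)^2 - (k₂:ℝ) ^ 2)) * h)) := by
  refine layer _ _ y _ hy ?_ _ ?_
  · intro m _
    by_contra! h
    exact lt_irrefl _ ((lt_ff _ _ _ _ _).1 h).1.1
  · intro s hs
    refine Real.le_sqrt_of_sq_le ?_
    refine interval_bound M _ hM _ ?_ ?_
    · intro m hm
      exact (Finset.mem_filter.1 (Finset.mem_filter.1 hm).1).2
    · intro m₁ h₁ m₂ h₂ m hm1 hm2
      simp only [Mset, Finset.mem_filter, Finset.mem_Icc, lt_ff] at *
      have r1 : (m₁:ℝ) ≤ m := by exact_mod_cast hm1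
      have r2 : (m:ℝ) ≤ m₂ := by exact_mod_cast hm2
      obtain ⟨⟨⟨i1, i2⟩, i3, i4⟩, ⟨a1, a2, a3⟩, ⟨a4, a5, a6⟩, a7, a8, a9⟩ := h₁
      obtain ⟨⟨⟨j1, j2⟩, j3, j4⟩, ⟨b1, b2, b3⟩, ⟨b4, b5, b6⟩, b7, b8, b9⟩ := h₂
      have q1 : (m₁:ℝ)^2 ≤ (m:ℝ)^2 := by gcongr
      have q2 : (m:ℝ)^2 ≤ (m₂:ℝ)^2 := by gcongr
      refine ⟨⟨⟨by omega, by omega⟩, by linarith, by linarith⟩, ⟨a1, ?_, ?_⟩, ⟨?_, a5, ?_⟩, ?_, ?_, a9⟩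
      · have := affine_between ((k₁:ℝ)^2 - (k₂:ℝ)^2) y s _ _ _ (by linarith) (by linarith) q1 q2
        linarith
      · have := affine_between ((k₁:ℝ)^2) (-x) s _ _ _ (by linarith) (by linarith) q1 q2
        linarith
      · have := affine_between ((k₂:ℝ)^2 - (k₁:ℝ)^2) y s _ _ _ (by linarith) (by linarith) q1 q2
        linarith
      · have := affine_between ((k₂:ℝ)^2) (-x) s _ _ _ (by linarith) (by linarith) q1 q2
        linarith
      · have := affine_between (-(k₁:ℝ)^2) (2*x+y) s _ _ _ (by linarith) (by linarith) q1 q2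
        linarith
      · have := affine_between (-(k₂:ℝ)^2) (2*x+y) s _ _ _ (by linarith) (by linarith) q1 q2
        linarith

lemma ff_zero (x y M : ℝ) (hx : 0 < x) (hM : 1 ≤ M) (m k₁ k₂ : ℕ) (hm : M ≤ m)
    (h : y / (2 * √x * M) < |(k₁:ℝ) - k₂|) :
    max (ff x y (((m:ℝ) * k₁) ^ 2) (((m:ℝ) * k₂) ^ 2)) 0 = 0 := by
  refine max_eq_right ?_
  by_contra! hlt
  rw [lt_ff] at hlt
  obtain ⟨⟨a1, a2, a3⟩, ⟨a4, a5, a6⟩, _⟩ := hlt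
  have hsx : 0 < √x := Real.sqrt_pos.2 hx
  rw [div_lt_iff₀ (by positivity)] at h
  have b1 : √x ≤ (m:ℝ) * k₁ := Real.sqrt_le_iff.2 ⟨by positivity, by linarith⟩
  have b2 : √x ≤ (m:ℝ) * k₂ := Real.sqrt_le_iff.2 ⟨by positivity, by linarith⟩
  have b3 : |((m:ℝ) * k₁) ^ 2 - ((m:ℝ) * k₂) ^ 2| < y := by rw [abs_lt]; constructor <;> linarith
  have b4 : ((m:ℝ) * k₁) ^ 2 - ((m:ℝ) * k₂) ^ 2 = (m * (m * k₁ + m * k₂)) * ((k₁:ℝ) - k₂) := by ring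
  rw [b4, abs_mul, abs_of_nonneg (by positivity)] at b3
  have b5 : M * (2 * √x) ≤ (m * ((m:ℝ) * k₁ + m * k₂)) := by
    gcongr; linarith
  have b6 := mul_le_mul_of_nonneg_right b5 (abs_nonneg ((k₁:ℝ) - k₂))
  linarith

lemma ii_sum {ι E : Type*} [NormedAddCommGroup E] (s : Finset ι) (f : ι → ℝ → E) (a b : ℝ)
    (h : ∀ i ∈ s, IntervalIntegrable (f i) volume a b) :
    IntervalIntegrable (fun t => ∑ i ∈ s, f i t) volume a b :=
  ⟨integrable_finsetSum s fun i hi => (h i hi).1, integrable_finsetSum s fun i hi => (h i hi).2⟩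

def gg (y α : ℝ) (b : ℕ → ℂ) (K m : ℕ) (t : ℝ) : ℂ :=
  ∑ k ∈ Finset.Icc 1 K, ((ind y (((m:ℝ) * k) ^ 2) t : ℝ) : ℂ) * (b k * e (α * ((m:ℝ) * k) ^ 2))

lemma gg_sq (y α : ℝ) (b : ℕ → ℂ) (K m : ℕ) (t : ℝ) :
    ((‖gg y α b K m t‖ ^ 2 : ℝ) : ℂ) = ∑ k₁ ∈ Finset.Icc 1 K, ∑ k₂ ∈ Finset.Icc 1 K,
      (((Set.Ico (max (((m:ℝ) * k₁) ^ 2 - y) (((m:ℝ) * k₂) ^ 2 - y)) (min (((m:ℝ) * k₁) ^ 2) (((m:ℝ) * k₂) ^ 2))).indicator (fun _ => (1:ℝ)) t : ℝ) : ℂ) *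
      (b k₁ * (starRingEnd ℂ) (b k₂) * e (α * ((k₁:ℝ)^2 - (k₂:ℝ) ^ 2) * (m:ℝ) ^ 2)) := by
  rw [Complex.ofReal_pow, ← Complex.mul_conj']
  unfold gg
  rw [map_sum, Finset.sum_mul_sum]
  refine Finset.sum_congr rfl fun k₁ _ => Finset.sum_congr rfl fun k₂ _ => ?_
  rw [← ind_mul, map_mul, map_mul, e_conj, Complex.conj_ofReal]
  have : e (α * ((k₁:ℝ)^2 - (k₂:ℝ) ^ 2) * (m:ℝ) ^ 2) =
      e (α * ((m:ℝ) * k₁) ^ 2) * e (-(α * ((m:ℝ) * k₂) ^ 2)) := by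
    rw [← e_add]; congr 1; ring
  rw [this]; push_cast; ring

lemma gg_sq_integrable (y α : ℝ) (b : ℕ → ℂ) (K m : ℕ) (l u : ℝ) :
    IntervalIntegrable (fun t => ‖gg y α b K m t‖ ^ 2) volume l u := by
  have h : IntervalIntegrable (fun t => ((‖gg y α b K m t‖ ^ 2 : ℝ) : ℂ)) volume l u := by
    simp only [gg_sq]
    exact ii_sum _ _ _ _ fun k₁ _ => ii_sum _ _ _ _ fun k₂ _ =>
      (ind_intervalIntegrable_c _ _ _ _).mul_const _
  have h3 : ∀ s, IntegrableOn (fun t => ((‖gg y α b K m t‖ ^ 2 : ℝ) : ℂ)) s volume →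
      IntegrableOn (fun t => ‖gg y α b K m t‖ ^ 2) s volume := by
    intro s hs
    have := hs.re
    simp only [RCLike.re_to_complex, Complex.ofReal_re] at this
    exact this
  exact ⟨h3 _ h.1, h3 _ h.2⟩

lemma gg_integral (x y α : ℝ) (hx : 0 ≤ x) (b : ℕ → ℂ) (K m : ℕ) :
    ((∫ t in x..(2 * x), ‖gg y α b K m t‖ ^ 2 : ℝ) : ℂ) =
    ∑ k₁ ∈ Finset.Icc 1 K, ∑ k₂ ∈ Finset.Icc 1 K,
      ((max (ff x y (((m:ℝ) * k₁) ^ 2) (((m:ℝ) * k₂) ^ 2)) 0 : ℝ) : ℂ) *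
      (b k₁ * (starRingEnd ℂ) (b k₂) * e (α * ((k₁:ℝ)^2 - (k₂:ℝ) ^ 2) * (m:ℝ) ^ 2)) := by
  rw [← intervalIntegral.integral_ofReal]
  simp only [gg_sq]
  rw [intervalIntegral.integral_finsetSum]
  · refine Finset.sum_congr rfl fun k₁ _ => ?_
    rw [intervalIntegral.integral_finsetSum]
    · refine Finset.sum_congr rfl fun k₂ _ => ?_
      rw [intervalIntegral.integral_mul_const, intervalIntegral.integral_ofReal,
        ind_integral _ _ _ _ (by linarith)]
      rfl
    · intro k₂ _
      exact (ind_intervalIntegrable_c _ _ _ _).mul_const _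
  · intro k₁ _
    exact ii_sum _ _ _ _ fun k₂ _ => (ind_intervalIntegrable_c _ _ _ _).mul_const _

def PhiP (α M : ℝ) (p : ℕ × ℕ) : ℝ :=
  ∑ h ∈ Finset.Ioo (-((⌊M⌋₊ + 1 : ℕ) : ℤ)) (⌊M⌋₊ + 1 : ℕ),
        phi (2 * M) (2 * (α * ((p.1:ℝ)^2 - (p.2:ℝ) ^ 2)) * h)

lemma mean_sq (x y M α : ℝ) (hx : 0 < x) (hy : 0 ≤ y) (hM : 1 ≤ M) (b : ℕ → ℂ) (N K : ℕ) :
    ∑ m ∈ Mset M N, ∫ t in x..(2 * x), ‖gg y α b K m t‖ ^ 2 ≤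
      ∑ p ∈ pairs K (y / (2 * √x * M)), ‖b p.1‖ * ‖b p.2‖ * (y * √(PhiP α M p)) := by
  set Z : ℕ × ℕ → ℂ := fun p => ∑ m ∈ Mset M N,
    ((max (ff x y (((m:ℝ) * p.1) ^ 2) (((m:ℝ) * p.2) ^ 2)) 0 : ℝ) : ℂ) *
        e (α * ((p.1:ℝ)^2 - (p.2:ℝ) ^ 2) * (m:ℝ) ^ 2) with hZ
  have h1 : ((∑ m ∈ Mset M N, ∫ t in x..(2 * x), ‖gg y α b K m t‖ ^ 2 : ℝ) : ℂ) =
      ∑ p ∈ pairs K (y / (2 * √x * M)), b p.1 * (starRingEnd ℂ) (b p.2) * Z p := by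
    rw [Complex.ofReal_sum]
    simp only [gg_integral x y α hx.le]
    simp_rw [← Finset.sum_product' (Finset.Icc 1 K) (Finset.Icc 1 K)]
    rw [Finset.sum_comm]
    unfold pairs
    rw [Finset.sum_filter]
    refine Finset.sum_congr rfl fun p _ => ?_
    split_ifs with hp
    · rw [hZ, Finset.mul_sum]
      refine Finset.sum_congr rfl fun m _ => ?_
      ring
    · refine Finset.sum_eq_zero fun m hm => ?_
      rw [ff_zero x y M hx hM m p.1 p.2 (Finset.mem_filter.1 hm).2.1 (not_le.1 hp)]
      simp
  have h2 : ∑ m ∈ Mset M N, ∫ t in x..(2 * x), ‖gg y α b K m t‖ ^ 2 ≤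
      ‖∑ p ∈ pairs K (y / (2 * √x * M)), b p.1 * (starRingEnd ℂ) (b p.2) * Z p‖ := by
    rw [← h1, Complex.norm_real]; exact le_abs_self _
  refine h2.trans ((norm_sum_le _ _).trans (Finset.sum_le_sum fun p _ => ?_))
  rw [norm_mul, norm_mul, RCLike.norm_conj]
  refine mul_le_mul_of_nonneg_left ?_ (by positivity)
  exact S_bound x y M α hy hM N p.1 p.2

lemma PhiP_nonneg (α M : ℝ) (hM : 1 ≤ M) (p : ℕ × ℕ) : 0 ≤ PhiP α M p :=
  Finset.sum_nonneg fun _ _ => phi_nonneg (by linarith) _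

lemma mean_sq2 (x y M α : ℝ) (hx : 0 < x) (hy : 0 ≤ y) (hM : 1 ≤ M) (b : ℕ → ℂ) (N K : ℕ) :
    ∑ m ∈ Mset M N, ∫ t in x..(2 * x), ‖gg y α b K m t‖ ^ 2 ≤
      y * √(((2 * (y / (2 * √x * M)) + 1) * ∑ k ∈ Finset.Icc 1 K, ‖b k‖ ^ 4) *
        ∑ p ∈ pairs K (y / (2 * √x * M)), PhiP α M p) := by
  refine (mean_sq x y M α hx hy hM b N K).trans ?_
  have : ∑ p ∈ pairs K (y / (2 * √x * M)), ‖b p.1‖ * ‖b p.2‖ * (y * √(PhiP α M p)) =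
      y * ∑ p ∈ pairs K (y / (2 * √x * M)), ‖b p.1‖ * ‖b p.2‖ * √(PhiP α M p) := by
    rw [Finset.mul_sum]; exact Finset.sum_congr rfl fun _ _ => by ring
  rw [this]
  refine mul_le_mul_of_nonneg_left (Real.le_sqrt_of_sq_le ?_) hy
  have hJ : 0 ≤ y / (2 * √x * M) := by positivity
  refine (Finset.sum_sq_le_sum_mul_sum_of_sq_le_mul _
    (f := fun p => ‖b p.1‖ ^ 2 * ‖b p.2‖ ^ 2) (g := PhiP α M) (fun _ _ => by positivity)
    (fun p _ => PhiP_nonneg α M hM p) (fun p _ => le_of_eq ?_)).trans ?_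
  · rw [mul_pow, Real.sq_sqrt (PhiP_nonneg α M hM p)]; ring
  · refine mul_le_mul_of_nonneg_right ?_ (Finset.sum_nonneg fun p _ => PhiP_nonneg α M hM p)
    have e1 := pair_sum K _ hJ (fun k => ‖b k‖ ^ 4) (fun _ => by positivity)
    have e2 := pair_sum2 K _ hJ (fun k => ‖b k‖ ^ 4) (fun _ => by positivity)
    have e3 : ∑ p ∈ pairs K (y / (2 * √x * M)), ‖b p.1‖ ^ 2 * ‖b p.2‖ ^ 2 ≤
        ∑ p ∈ pairs K (y / (2 * √x * M)), (‖b p.1‖ ^ 4 / 2 + ‖b p.2‖ ^ 4 / 2) := by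
      refine Finset.sum_le_sum fun p _ => ?_
      nlinarith [sq_nonneg (‖b p.1‖ ^ 2 - ‖b p.2‖ ^ 2)]
    rw [Finset.sum_add_distrib, ← Finset.sum_div, ← Finset.sum_div] at e3
    linarith

lemma F_eq (x y M α : ℝ) (hx : 1 ≤ x) (hyx : y ≤ x) (hM : 1 ≤ M) (am bk : ℕ → ℂ) (t : ℝ)
    (ht : t ≤ 2 * x) :
    ∑ m ∈ Finset.Icc 1 ⌊3 * x⌋₊, ∑ k ∈ Finset.Icc 1 ⌊3 * x⌋₊,
          (if M ≤ (m : ℝ) ∧ (m : ℝ) < 2 * M ∧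
              t < ((m : ℝ) * (k : ℝ)) ^ 2 ∧ ((m : ℝ) * (k : ℝ)) ^ 2 ≤ t + y
           then am m * bk k * e (α * ((m : ℝ) * (k : ℝ)) ^ 2) else 0) =
    ∑ m ∈ Mset M ⌊3 * x⌋₊, am m * gg y α bk ⌊2 * √x / M⌋₊ m t := by
  have hsx : √x ≤ x := by
    rw [Real.sqrt_le_left (by linarith)]; nlinarith
  have hKN : ⌊2 * √x / M⌋₊ ≤ ⌊3 * x⌋₊ := by
    refine Nat.floor_le_floor ?_
    rw [div_le_iff₀ (by linarith)]
    nlinarith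
  unfold Mset
  rw [Finset.sum_filter]
  refine Finset.sum_congr rfl fun m _ => ?_
  split_ifs with hm
  · unfold gg
    rw [Finset.mul_sum]
    symm
    refine Finset.sum_subset_zero_on_sdiff (Finset.Icc_subset_Icc le_rfl hKN) ?_ ?_
    · intro k hk
      rw [if_neg]
      rintro ⟨_, _, _, h⟩
      have hk' : ⌊2 * √x / M⌋₊ < k := by
        simp only [Finset.mem_sdiff, Finset.mem_Icc] at hk; omega
      rw [Nat.floor_lt (by positivity), div_lt_iff₀ (by linarith)] at hk'
      have : 2 * √x < m * k := by
        have : (k:ℝ) * M ≤ m * k := by rw [mul_comm]; gcongr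
        linarith
      have h4 : (2 * √x) ^ 2 < (m * k : ℝ) ^ 2 := by gcongr
      rw [mul_pow, Real.sq_sqrt (by linarith)] at h4
      linarith
    · intro k _
      unfold ind
      by_cases h : t < ((m : ℝ) * (k : ℝ)) ^ 2 ∧ ((m : ℝ) * (k : ℝ)) ^ 2 ≤ t + y
      · rw [if_pos h, if_pos ⟨hm.1, hm.2, h⟩]; push_cast; ring
      · rw [if_neg h, if_neg (fun h' => h h'.2.2)]; simp
  · refine Finset.sum_eq_zero fun k _ => ?_
    rw [if_neg (fun h => hm ⟨h.1, h.2.1⟩)]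

lemma total (x y M α : ℝ) (hx : 1 ≤ x) (hy : 0 ≤ y) (hyx : y ≤ x) (hM : 1 ≤ M) (am bk : ℕ → ℂ) :
    (∫ t in x..(2 * x),
        ‖∑ m ∈ Finset.Icc 1 ⌊3 * x⌋₊, ∑ k ∈ Finset.Icc 1 ⌊3 * x⌋₊,
          (if M ≤ (m : ℝ) ∧ (m : ℝ) < 2 * M ∧
              t < ((m : ℝ) * (k : ℝ)) ^ 2 ∧ ((m : ℝ) * (k : ℝ)) ^ 2 ≤ t + y
           then am m * bk k * e (α * ((m : ℝ) * (k : ℝ)) ^ 2) else 0)‖ ^ 2) ≤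
    (∑ m ∈ Mset M ⌊3 * x⌋₊, ‖am m‖ ^ 2) *
      (y * √(((2 * (y / (2 * √x * M)) + 1) * ∑ k ∈ Finset.Icc 1 ⌊2 * √x / M⌋₊, ‖bk k‖ ^ 4) *
        ∑ p ∈ pairs ⌊2 * √x / M⌋₊ (y / (2 * √x * M)), PhiP α M p)) := by
  set K := ⌊2 * √x / M⌋₊
  have hx2 : x ≤ 2 * x := by linarith
  have hint : IntervalIntegrable (fun t => (∑ m ∈ Mset M ⌊3 * x⌋₊, ‖am m‖ ^ 2) *
      ∑ m ∈ Mset M ⌊3 * x⌋₊, ‖gg y α bk K m t‖ ^ 2) volume x (2 * x) := by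
    refine IntervalIntegrable.const_mul ?_ _
    exact ii_sum _ _ _ _ fun m _ => gg_sq_integrable _ _ _ _ _ _ _
  refine le_trans (b := ∫ t in x..(2 * x), (∑ m ∈ Mset M ⌊3 * x⌋₊, ‖am m‖ ^ 2) *
      ∑ m ∈ Mset M ⌊3 * x⌋₊, ‖gg y α bk K m t‖ ^ 2) ?_ ?_
  · rw [intervalIntegral.integral_of_le hx2, intervalIntegral.integral_of_le hx2]
    refine integral_mono_of_nonneg (Filter.Eventually.of_forall fun t => by positivity) hint.1 ?_
    refine (ae_restrict_iff' measurableSet_Ioc).2 (Filter.Eventually.of_forall fun t ht => ?_)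
    simp only
    rw [F_eq x y M α hx hyx hM am bk t ht.2]
    have h1 : ‖∑ m ∈ Mset M ⌊3 * x⌋₊, am m * gg y α bk K m t‖ ≤
        ∑ m ∈ Mset M ⌊3 * x⌋₊, ‖am m‖ * ‖gg y α bk K m t‖ := by
      refine (norm_sum_le _ _).trans (le_of_eq ?_)
      simp only [norm_mul]
    refine le_trans ?_ (Finset.sum_mul_sq_le_sq_mul_sq _ _ _)
    gcongr
  · rw [intervalIntegral.integral_const_mul, intervalIntegral.integral_finsetSum
      (fun m _ => gg_sq_integrable _ _ _ _ _ _ _)]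
    refine mul_le_mul_of_nonneg_left ?_ (Finset.sum_nonneg fun _ _ => by positivity)
    exact mean_sq2 x y M α (by linarith) hy hM bk _ K

lemma log_bd (x X : ℝ) (hx : 1 ≤ x) (hL : 4 ≤ Real.log x) (hX : 1 ≤ X) (hXx : X ≤ 8 * x) :
    1 ≤ 1 + Real.log X ∧ 1 + Real.log X ≤ 2 * Real.log x := by
  have h1 := Real.log_nonneg hX
  have h2 : Real.log X ≤ Real.log (8 * x) := Real.log_le_log (by linarith) hXx
  rw [Real.log_mul (by norm_num) (by linarith)] at h2
  have h3 : Real.log 8 ≤ 3 := by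
    rw [show (8:ℝ) = 2 ^ 3 by norm_num, Real.log_pow]
    have := Real.log_two_lt_d9
    push_cast; linarith
  exact ⟨by linarith, by linarith⟩

set_option maxHeartbeats 1000000 in
lemma PhiSum_bound (x y M α θ : ℝ) (a : ℤ) (q : ℕ) (hx : 1 ≤ x) (hL : 4 ≤ Real.log x)
    (hθ : 0 < θ) (hθ1 : θ ≤ 1) (hsy : √x ≤ y) (hyx : y ≤ x)
    (hq1 : 1 ≤ θ ^ 4 * q) (hq2 : (q:ℝ) ≤ y * θ ^ 4) (hM1 : 1 ≤ θ ^ 4 * M) (hM2 : M * √x ≤ y * θ ^ 4)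
    (hg : Int.gcd a q = 1) (hα : |α - (a : ℝ) / (q : ℝ)| < 1 / (q : ℝ) ^ 2) :
    ∑ p ∈ pairs ⌊2 * √x / M⌋₊ (y / (2 * √x * M)), PhiP α M p ≤
      212 * y * θ ^ 2 * (2 * Real.log x) ^ 9 := by
  set L := Real.log x with hLdef
  set s := √x with hs
  set ε := θ ^ 4 with hε
  have hs1 : 1 ≤ s := Real.one_le_sqrt.2 hx
  have hε0 : 0 < ε := by positivity
  have hε1 : ε ≤ 1 := pow_le_one₀ hθ.le hθ1
  have hM : 1 ≤ M := by nlinarith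
  have hq0 : 1 ≤ q := by
    rcases Nat.eq_zero_or_pos q with h | h
    · rw [h] at hq1; simp at hq1; linarith
    · exact h
  have hqr : (1:ℝ) ≤ q := by exact_mod_cast hq0
  have hy1 : 1 ≤ y := by linarith
  set K := ⌊2 * s / M⌋₊ with hK
  set J := y / (2 * s * M) with hJ
  have hKle : (K:ℝ) ≤ 2 * s / M := Nat.floor_le (by positivity)
  have hsM : s * M ≤ y := by nlinarith
  have hJ0 : 1 ≤ 2 * J := by
    rw [hJ, ← mul_div_assoc, le_div_iff₀ (by positivity)]; linarith
  have hRn : ((⌊M⌋₊ + 1 : ℕ) : ℝ) ≤ 2 * M := by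
    push_cast
    have := Nat.floor_le (a := M) (by linarith)
    linarith
  set N := ⌊8 * y / M⌋₊ with hN
  have hNle : (N:ℝ) ≤ 8 * y / M := Nat.floor_le (by positivity)
  have hNu : ∀ p ∈ pairs K J, ∀ h ∈ Finset.Ioo (-((⌊M⌋₊ + 1 : ℕ) : ℤ)) (⌊M⌋₊ + 1 : ℕ), nu (p, h) ≤ N := by
    intro p hp h hh
    refine Nat.le_floor ?_
    simp only [pairs, Finset.mem_filter, Finset.mem_product, Finset.mem_Icc] at hp
    rw [Finset.mem_Ioo] at hh
    obtain ⟨⟨⟨_, hp1⟩, _, hp2⟩, hp3⟩ := hp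
    have b1 : ((((p.1:ℤ) - p.2).natAbs : ℕ) : ℝ) ≤ J := by
      rw [Nat.cast_natAbs, Int.cast_abs]; push_cast; exact hp3
    have b2 : ((h.natAbs : ℕ) : ℝ) ≤ 2 * M := by
      refine le_trans ?_ hRn
      have : h.natAbs ≤ ⌊M⌋₊ + 1 := by omega
      exact_mod_cast this
    have b3 : ((p.1 + p.2 : ℕ) : ℝ) ≤ 2 * (2 * s / M) := by
      have c1 : (p.1 : ℝ) ≤ K := by exact_mod_cast hp1
      have c2 : (p.2 : ℝ) ≤ K := by exact_mod_cast hp2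
      push_cast; linarith
    rw [nu_eq]
    calc _ = 2 * (((((p.1:ℤ) - p.2).natAbs : ℕ) : ℝ) * ((p.1 + p.2 : ℕ) : ℝ)) * ((h.natAbs : ℕ) : ℝ) := by
          push_cast; ring
      _ ≤ 2 * (J * (2 * (2 * s / M))) * (2 * M) := by gcongr
      _ = 8 * y / M := by rw [hJ]; field_simp; ring
  have hmain := Phi_bound α (2 * M) J (by linarith) K (⌊M⌋₊ + 1) N hNu
  have hcard : ((pairs K J).card : ℝ) ≤ 4 * y / M ^ 2 := by
    have := pair_sum K J (by linarith) (fun _ => 1) (fun _ => zero_le_one)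
    simp at this
    calc _ ≤ (2 * J + 1) * K := this
      _ ≤ (4 * J) * (2 * s / M) := by gcongr; linarith
      _ = 4 * y / M ^ 2 := by rw [hJ]; field_simp
  have hyM : y / M ≤ y * ε := by
    rw [div_le_iff₀ (by linarith), mul_assoc]; exact le_mul_of_one_le_right (by linarith) hM1
  have h0 : (2 * M) * ((pairs K J).card + 2 * K * ((⌊M⌋₊ + 1 : ℕ) : ℝ)) ≤ 24 * (y * ε) := by
    calc _ ≤ (2 * M) * (4 * y / M ^ 2 + 2 * (2 * s / M) * (2 * M)) := by gcongr
      _ = 8 * (y / M) + 16 * (M * s) := by field_simp; ring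
      _ ≤ _ := by linarith
  set Q := ∑ n ∈ Finset.Icc 1 N, (n.divisors.card : ℝ) ^ 2 * phi (2 * M) (α * n) with hQ
  have hMx : M ≤ y := by nlinarith
  have hX1 : 1 ≤ 8 * y / M := by rw [le_div_iff₀ (by linarith)]; linarith
  have hX2 : 8 * y / M ≤ 8 * x := by
    refine (div_le_self (by linarith) hM).trans (by linarith)
  obtain ⟨l1, l2⟩ := log_bd x (8 * y / M) hx hL hX1 hX2
  have hqx : (q:ℝ) ≤ x := by nlinarith
  obtain ⟨l3, l4⟩ := log_bd x (2 * q) hx hL (by linarith) (by linarith)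
  have c1 : ∑ n ∈ Finset.Icc 1 N, (n.divisors.card : ℝ) ^ 4 ≤ 8 * y / M * (2 * L) ^ 16 := by
    refine (tau_S' (8 * y / M) hX1 N 4 hNle).trans ?_
    norm_num
    gcongr
  have c2 : ∑ n ∈ Finset.Icc 1 N, phi (2 * M) (α * n) ≤ 136 * (y * ε) * (2 * L) := by
    refine (phi_sum α a q hq0 hg hα (2 * M) (by linarith) N).trans ?_
    calc _ ≤ (2 * (8 * y / M) / q + 1) * (2 * (2 * M) + 4 * q * (2 * L)) := by gcongr
      _ = 64 * (y / q) + 64 * (y / M) * (2 * L) + 4 * M + 4 * q * (2 * L) := by field_simp; ring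
      _ ≤ 64 * (y * ε * (2 * L)) + 64 * (y * ε) * (2 * L) + 4 * (y * ε * (2 * L)) + 4 * (y * ε) * (2 * L) := by
          have d1 : y / q ≤ y * ε := by
            rw [div_le_iff₀ (by linarith), mul_assoc]; exact le_mul_of_one_le_right (by linarith) hq1
          have d2 : y * ε ≤ y * ε * (2 * L) := le_mul_of_one_le_right (by positivity) (by linarith)
          have d3 : M ≤ y * ε := le_trans (le_mul_of_one_le_right (by linarith) hs1) hM2
          gcongr
          · linarith
          · linarith
      _ = _ := by ring
  have c3 : Q ^ 2 ≤ (47 * y * θ ^ 2 * (2 * L) ^ 9) ^ 2 := by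
    refine (cs_tau α (2 * M) (by linarith) N).trans ?_
    calc _ ≤ ((2 * M) * (8 * y / M * (2 * L) ^ 16)) * (136 * (y * ε) * (2 * L)) := by
          gcongr
          exact Finset.sum_nonneg fun _ _ => phi_nonneg (by linarith) _
      _ = 2176 * y ^ 2 * ε * (2 * L) ^ 17 := by field_simp; ring
      _ ≤ 2209 * y ^ 2 * ε * (2 * L) ^ 18 := by
          gcongr
          · norm_num
          · linarith
          · norm_num
      _ = _ := by rw [hε]; ring
  have c4 : Q ≤ 47 * y * θ ^ 2 * (2 * L) ^ 9 := (abs_le_of_sq_le_sq' c3 (by positivity)).2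
  have c5 : y * ε ≤ y * θ ^ 2 * (2 * L) ^ 9 := by
    have f1 : ε ≤ θ ^ 2 := pow_le_pow_of_le_one hθ.le hθ1 (by norm_num)
    have f2 : (1:ℝ) ≤ (2 * L) ^ 9 := one_le_pow₀ (by linarith)
    calc y * ε ≤ y * θ ^ 2 * 1 := by rw [mul_one]; gcongr
      _ ≤ _ := by gcongr
  refine hmain.trans ?_
  linarith

set_option maxHeartbeats 1000000 in
lemma core (c x y M α θ : ℝ) (r : ℕ) (hr : c ≤ r) (a : ℤ) (q : ℕ) (hx : 1 ≤ x) (hL : 4 ≤ Real.log x)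
    (hθ : 0 < θ) (hθ1 : θ ≤ 1) (hsy : √x ≤ y) (hyx : y ≤ x)
    (hq1 : 1 ≤ θ ^ 4 * q) (hq2 : (q:ℝ) ≤ y * θ ^ 4) (hM1 : 1 ≤ θ ^ 4 * M) (hM2 : M * √x ≤ y * θ ^ 4)
    (hg : Int.gcd a q = 1) (hα : |α - (a : ℝ) / (q : ℝ)| < 1 / (q : ℝ) ^ 2)
    (am bk : ℕ → ℂ)
    (ham : ∀ m : ℕ, 1 ≤ m → ‖am m‖ ≤ (m.divisors.card : ℝ) ^ c)
    (hbk : ∀ k : ℕ, 1 ≤ k → ‖bk k‖ ≤ (k.divisors.card : ℝ) ^ c) :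
    (∫ t in x..(2 * x),
        ‖∑ m ∈ Finset.Icc 1 ⌊3 * x⌋₊, ∑ k ∈ Finset.Icc 1 ⌊3 * x⌋₊,
          (if M ≤ (m : ℝ) ∧ (m : ℝ) < 2 * M ∧
              t < ((m : ℝ) * (k : ℝ)) ^ 2 ∧ ((m : ℝ) * (k : ℝ)) ^ 2 ≤ t + y
           then am m * bk k * e (α * ((m : ℝ) * (k : ℝ)) ^ 2) else 0)‖ ^ 2) ≤
    60 * y ^ 2 * θ * (2 * Real.log x) ^ (2 ^ (r * 2) + 2 ^ (r * 4) + 9) := by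
  have hPhi := PhiSum_bound x y M α θ a q hx hL hθ hθ1 hsy hyx hq1 hq2 hM1 hM2 hg hα
  set L := Real.log x with hLdef
  set s := √x with hs
  have hs1 : 1 ≤ s := Real.one_le_sqrt.2 hx
  have hε1 : θ ^ 4 ≤ 1 := pow_le_one₀ hθ.le hθ1
  have hε0 : 0 < θ ^ 4 := by positivity
  have hM : 1 ≤ M := by nlinarith
  have hy1 : 1 ≤ y := by linarith
  have hss : s * s = x := Real.mul_self_sqrt (by linarith)
  have hsM : s * M ≤ y := by nlinarith
  have hMs : M ≤ s := by
    by_contra! h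
    nlinarith
  have hsx : s ≤ x := by nlinarith
  have hpow : ∀ (b : ℕ → ℂ), (∀ k : ℕ, 1 ≤ k → ‖b k‖ ≤ (k.divisors.card : ℝ) ^ c) →
      ∀ (j k : ℕ), 1 ≤ k → ‖b k‖ ^ j ≤ (k.divisors.card : ℝ) ^ (r * j) := by
    intro b hb j k hk
    rw [pow_mul]
    refine pow_le_pow_left₀ (norm_nonneg _) ((hb k hk).trans ?_) j
    rw [← Real.rpow_natCast]
    refine Real.rpow_le_rpow_of_exponent_le ?_ hr
    have : 0 < k.divisors.card := Finset.card_pos.2 ⟨1, Nat.one_mem_divisors.2 (by omega)⟩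
    exact_mod_cast this
  have hA : ∑ m ∈ Mset M ⌊3 * x⌋₊, ‖am m‖ ^ 2 ≤ 2 * M * (2 * L) ^ (2 ^ (r * 2)) := by
    obtain ⟨l1, l2⟩ := log_bd x (2 * M) hx hL (by linarith) (by linarith)
    calc _ ≤ ∑ m ∈ Finset.Icc 1 ⌊2 * M⌋₊, (m.divisors.card : ℝ) ^ (r * 2) := by
          refine le_trans (Finset.sum_le_sum (g := fun m : ℕ => (m.divisors.card : ℝ) ^ (r * 2)) ?_)
            (Finset.sum_le_sum_of_subset_of_nonneg ?_ (fun _ _ _ => by positivity))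
          · intro m hm
            simp only [Mset, Finset.mem_filter, Finset.mem_Icc] at hm
            exact hpow am ham 2 m hm.1.1
          · intro m hm
            simp only [Mset, Finset.mem_filter, Finset.mem_Icc] at hm
            exact Finset.mem_Icc.2 ⟨hm.1.1, Nat.le_floor hm.2.2.le⟩
      _ ≤ 2 * M * (1 + Real.log (2 * M)) ^ (2 ^ (r * 2)) :=
          tau_S' (2 * M) (by linarith) _ _ (Nat.floor_le (by linarith))
      _ ≤ _ := by gcongr
  have hB : ∑ k ∈ Finset.Icc 1 ⌊2 * s / M⌋₊, ‖bk k‖ ^ 4 ≤ 2 * s / M * (2 * L) ^ (2 ^ (r * 4)) := by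
    have g1 : 1 ≤ 2 * s / M := by rw [le_div_iff₀ (by linarith)]; linarith
    have g2 : 2 * s / M ≤ 8 * x := (div_le_self (by linarith) hM).trans (by linarith)
    obtain ⟨l1, l2⟩ := log_bd x (2 * s / M) hx hL g1 g2
    calc _ ≤ ∑ k ∈ Finset.Icc 1 ⌊2 * s / M⌋₊, (k.divisors.card : ℝ) ^ (r * 4) :=
          Finset.sum_le_sum fun k hk => hpow bk hbk 4 k (Finset.mem_Icc.1 hk).1
      _ ≤ 2 * s / M * (1 + Real.log (2 * s / M)) ^ (2 ^ (r * 4)) :=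
          tau_S' _ g1 _ _ (Nat.floor_le (by positivity))
      _ ≤ _ := by gcongr
  have hJ0 : 1 ≤ 2 * (y / (2 * s * M)) := by
    rw [← mul_div_assoc, le_div_iff₀ (by positivity)]; linarith
  have hP0 : 0 ≤ ∑ p ∈ pairs ⌊2 * s / M⌋₊ (y / (2 * s * M)), PhiP α M p :=
    Finset.sum_nonneg fun p _ => PhiP_nonneg α M hM p
  have hS : √(((2 * (y / (2 * s * M)) + 1) * ∑ k ∈ Finset.Icc 1 ⌊2 * s / M⌋₊, ‖bk k‖ ^ 4) *
        ∑ p ∈ pairs ⌊2 * s / M⌋₊ (y / (2 * s * M)), PhiP α M p) ≤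
      30 * y / M * θ * (2 * L) ^ (2 ^ (r * 4) + 9) := by
    refine Real.sqrt_le_iff.2 ⟨by positivity, ?_⟩
    calc _ ≤ ((4 * (y / (2 * s * M))) * (2 * s / M * (2 * L) ^ (2 ^ (r * 4)))) *
          (212 * y * θ ^ 2 * (2 * L) ^ 9) := by
          gcongr
          linarith
      _ = 848 * (y ^ 2 / M ^ 2 * θ ^ 2) * (2 * L) ^ (2 ^ (r * 4) + 9) := by
          rw [pow_add]; field_simp; ring
      _ ≤ 900 * (y ^ 2 / M ^ 2 * θ ^ 2) * (2 * L) ^ ((2 ^ (r * 4) + 9) * 2) := by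
          gcongr
          · norm_num
          · linarith
          · omega
      _ = _ := by rw [pow_mul]; ring
  refine (total x y M α hx (by linarith) hyx hM am bk).trans ?_
  calc _ ≤ (2 * M * (2 * L) ^ (2 ^ (r * 2))) * (y * (30 * y / M * θ * (2 * L) ^ (2 ^ (r * 4) + 9))) := by
        gcongr
    _ = _ := by
        rw [add_assoc, pow_add (2 * L) (2 ^ (r * 2))]; field_simp; ring

/-- Lemma 2 of the paper. -/
theorem statement7 :
    ∀ A c : ℝ, 0 < A → 0 < c → ∃ B₀ : ℝ, 0 < B₀ ∧ ∃ C : ℝ, 0 < C ∧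
    ∀ B : ℝ, B₀ ≤ B → ∃ x₀ : ℝ, ∀ x : ℝ, x₀ ≤ x →
    ∀ (y α M : ℝ) (a q : ℤ) (am bk : ℕ → ℂ) (L : ℝ), L = Real.log x →
    x ^ (1/2 : ℝ) ≤ y → y ≤ x →
    L ^ B ≤ (q : ℝ) → (q : ℝ) ≤ y * L ^ (-B) → Int.gcd a q = 1 →
    |α - (a : ℝ) / (q : ℝ)| < (q : ℝ) ^ (-2 : ℝ) →
    (∀ m : ℕ, 1 ≤ m → ‖am m‖ ≤ (m.divisors.card : ℝ) ^ c) →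
    (∀ k : ℕ, 1 ≤ k → ‖bk k‖ ≤ (k.divisors.card : ℝ) ^ c) →
    L ^ B ≤ M → M ≤ y * x ^ (-1/2 : ℝ) * L ^ (-B) →
    (∫ t in x..(2 * x),
        ‖∑ m ∈ Finset.Icc 1 ⌊3 * x⌋₊, ∑ k ∈ Finset.Icc 1 ⌊3 * x⌋₊,
          (if M ≤ (m : ℝ) ∧ (m : ℝ) < 2 * M ∧
              t < ((m : ℝ) * (k : ℝ)) ^ 2 ∧ ((m : ℝ) * (k : ℝ)) ^ 2 ≤ t + y
           then am m * bk k * e (α * ((m : ℝ) * (k : ℝ)) ^ 2) else 0)‖ ^ 2)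
      ≤ C * y ^ 2 * L ^ (-A) := by
  intro A c hA hc
  obtain ⟨r, hr⟩ := exists_nat_ge c
  set E : ℕ := 2 ^ (r * 2) + 2 ^ (r * 4) + 9 with hE
  refine ⟨4 * (A + E + 1), by positivity, 1, one_pos, ?_⟩
  intro B hB
  refine ⟨Real.exp (60 * 2 ^ E), ?_⟩
  intro x hx y α M a q am bk L hLx hsy hyx hq1 hq2 hg hα ham hbk hM1 hM2
  have hx0 : 0 < x := (Real.exp_pos _).trans_le hx
  have hLbig : 60 * 2 ^ E ≤ L := by
    rw [hLx, Real.le_log_iff_exp_le hx0]; exact hx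
  have h2E : (1:ℝ) ≤ 2 ^ E := one_le_pow₀ (by norm_num)
  have hL4 : 4 ≤ L := by linarith
  have hL0 : 0 < L := by linarith
  have hx1 : 1 ≤ x := by
    refine le_trans ?_ hx
    exact Real.one_le_exp (by positivity)
  have hB0 : 0 < B := lt_of_lt_of_le (by positivity) hB
  set θ : ℝ := L ^ (-B / 4) with hθdef
  have hθ : 0 < θ := Real.rpow_pos_of_pos hL0 _
  have hθ1 : θ ≤ 1 := Real.rpow_le_one_of_one_le_of_nonpos (by linarith) (by linarith)
  have hθ4 : θ ^ 4 = L ^ (-B) := by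
    rw [hθdef, ← Real.rpow_natCast, ← Real.rpow_mul hL0.le]
    congr 1; push_cast; ring
  have hLB : 0 < L ^ B := Real.rpow_pos_of_pos hL0 _
  have hinv : θ ^ 4 * L ^ B = 1 := by
    rw [hθ4, ← Real.rpow_add hL0]; simp
  have hqpos : (0:ℝ) < q := lt_of_lt_of_le hLB hq1
  have hqpos' : 0 < q := by exact_mod_cast hqpos
  lift q to ℕ using hqpos'.le
  rw [Int.cast_natCast] at *
  have hsqrt : x ^ (1/2:ℝ) = √x := (Real.sqrt_eq_rpow x).symm
  have hsx : 0 < √x := Real.sqrt_pos.2 hx0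
  have hinvs : x ^ (-1/2:ℝ) * √x = 1 := by
    rw [Real.sqrt_eq_rpow, ← Real.rpow_add hx0]; norm_num
  have hα' : |α - (a : ℝ) / (q : ℝ)| < 1 / (q : ℝ) ^ 2 := by
    refine lt_of_lt_of_eq hα ?_
    rw [Real.rpow_neg hqpos.le, one_div]
    norm_num
  have key := core c x y M α θ r hr a q hx1 (hLx ▸ hL4) hθ hθ1 (hsqrt ▸ hsy) hyx
    (by rw [← hinv]; gcongr) (by rw [hθ4]; exact hq2) (by rw [← hinv]; gcongr)
    (by
      rw [hθ4]
      calc M * √x ≤ (y * x ^ (-1/2 : ℝ) * L ^ (-B)) * √x := by gcongr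
        _ = y * L ^ (-B) * (x ^ (-1/2:ℝ) * √x) := by ring
        _ = _ := by rw [hinvs, mul_one])
    hg hα' am bk ham hbk
  refine key.trans ?_
  rw [← hLx, ← hE, one_mul]
  have h1 : 60 * y ^ 2 * θ * (2 * L) ^ E = y ^ 2 * ((60 * 2 ^ E) * (θ * L ^ E)) := by
    rw [mul_pow]; ring
  rw [h1]
  refine mul_le_mul_of_nonneg_left ?_ (by positivity)
  calc (60 * 2 ^ E) * (θ * L ^ E) ≤ L * (θ * L ^ E) := by gcongr
    _ = L ^ (1 + (-B / 4 + E)) := by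
        rw [Real.rpow_add hL0, Real.rpow_add hL0, Real.rpow_one, Real.rpow_natCast]
    _ ≤ L ^ (-A) := Real.rpow_le_rpow_of_exponent_le (by linarith) (by linarith)
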